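/- arXiv:2402.05875 — 12 statements merged into one kernel-verified Lean document; each statement's English description precedes it below -/
import Mathlib

section
/- The triple model of the monogenic free inverse semigroup is an inverse semigroup: the set FI₁ = {(a, p, b) ∈ ℕ × ℤ × ℕ : a + b > 0 and -a ≤ p ≤ b} is closed under the multiplication (a₁, p₁, b₁)·(a₂, p₂, b₂) = (max(a₁, a₂ - p₁), p₁ + p₂, max(b₁, b₂ + p₁)) and under the inversion (a, p, b)⁻¹ = (a + p, -p, b - p); the multiplication is associative; u·u⁻¹·u = u for every u ∈ FI₁; and e·f = f·e for all e, f ∈ FI₁ with e·e = e and f·f = f. -/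
/-- Multiplication on triples modeling the monogenic free inverse semigroup:
the triple `(a, p, b)` encodes the element written `(-a, p, b)` in the paper. -/
def FI1mul (u v : ℤ × ℤ × ℤ) : ℤ × ℤ × ℤ :=
  (max u.1 (v.1 - u.2.1), u.2.1 + v.2.1, max u.2.2 (v.2.2 + u.2.1))

/-- Inversion on triples: `(a, p, b)⁻¹ = (a + p, -p, b - p)`. -/
def FI1inv (u : ℤ × ℤ × ℤ) : ℤ × ℤ × ℤ :=
  (u.1 + u.2.1, -u.2.1, u.2.2 - u.2.1)

/-- The monogenic free inverse semigroup in its concrete triple model: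
triples `(a, p, b)` with `a, b ∈ ℕ`, `a + b > 0` and `-a ≤ p ≤ b`. -/
def FI1 : Set (ℤ × ℤ × ℤ) :=
  {u | 0 ≤ u.1 ∧ 0 ≤ u.2.2 ∧ 0 < u.1 + u.2.2 ∧ -u.1 ≤ u.2.1 ∧ u.2.1 ≤ u.2.2}

/-- Membership in the smallest subset containing `X` that is closed under
multiplication and inversion. -/
inductive FI1genMem (X : Set (ℤ × ℤ × ℤ)) : ℤ × ℤ × ℤ → Prop
  | base {u : ℤ × ℤ × ℤ} : u ∈ X → FI1genMem X u
  | mul {u v : ℤ × ℤ × ℤ} : FI1genMem X u → FI1genMem X v → FI1genMem X (FI1mul u v)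
  | inv {u : ℤ × ℤ × ℤ} : FI1genMem X u → FI1genMem X (FI1inv u)

/-- `⟨X⟩`: the smallest subset containing `X` closed under multiplication and inversion. -/
def FI1gen (X : Set (ℤ × ℤ × ℤ)) : Set (ℤ × ℤ × ℤ) := {u | FI1genMem X u}

/-- A (nonempty) inverse subsemigroup of `FI₁`. -/
def IsInvSub (S : Set (ℤ × ℤ × ℤ)) : Prop :=
  S.Nonempty ∧ S ⊆ FI1 ∧ (∀ u ∈ S, ∀ v ∈ S, FI1mul u v ∈ S) ∧ ∀ u ∈ S, FI1inv u ∈ S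

theorem stmt_0 :
    (∀ u ∈ FI1, ∀ v ∈ FI1, FI1mul u v ∈ FI1) ∧
    (∀ u ∈ FI1, FI1inv u ∈ FI1) ∧
    (∀ u ∈ FI1, ∀ v ∈ FI1, ∀ w ∈ FI1,
      FI1mul (FI1mul u v) w = FI1mul u (FI1mul v w)) ∧
    (∀ u ∈ FI1, FI1mul (FI1mul u (FI1inv u)) u = u) ∧
    (∀ e ∈ FI1, ∀ f ∈ FI1, FI1mul e e = e → FI1mul f f = f →
      FI1mul e f = FI1mul f e) := by
  refine ⟨?_, ?_, ?_, ?_, ?_⟩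
  · rintro ⟨a, p, b⟩ hu ⟨c, q, d⟩ hv
    simp only [FI1, FI1mul, Set.mem_ofPred_eq] at *
    omega
  · rintro ⟨a, p, b⟩ hu
    simp only [FI1, FI1inv, Set.mem_ofPred_eq] at *
    omega
  · rintro ⟨a, p, b⟩ - ⟨c, q, d⟩ - ⟨x, r, y⟩ -
    simp only [FI1mul, Prod.mk.injEq]
    omega
  · rintro ⟨a, p, b⟩ hu
    simp only [FI1, FI1mul, FI1inv, Set.mem_ofPred_eq, Prod.mk.injEq] at *
    omega
  · rintro ⟨a, p, b⟩ - ⟨c, q, d⟩ - he hf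
    simp only [FI1mul, Prod.mk.injEq] at *
    omega
end

section
/- For u = (a, p, b) and v = (a', p', b') in FI₁, there exists w ∈ FI₁ with u·u⁻¹ = w·w⁻¹ and w⁻¹·w = v⁻¹·v if and only if a + b = a' + b'; consequently the Green D-classes of FI₁ are the sets D_n = {(a, p, b) ∈ FI₁ : a + b = n} for n ∈ ℕ, n ≥ 1, and each D-class D_n is a finite set. -/
theorem FI1mul_inv_self (u : ℤ × ℤ × ℤ) : FI1mul u (FI1inv u) = (u.1, 0, u.2.2) := by
  simp [FI1mul, FI1inv]

theorem FI1inv_mul_self (u : ℤ × ℤ × ℤ) :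
    FI1mul (FI1inv u) u = (u.1 + u.2.1, 0, u.2.2 - u.2.1) := by
  simp [FI1mul, FI1inv, sub_eq_add_neg]

theorem stmt_3 :
    (∀ u ∈ FI1, ∀ v ∈ FI1,
      ((∃ w ∈ FI1, FI1mul u (FI1inv u) = FI1mul w (FI1inv w) ∧
          FI1mul (FI1inv w) w = FI1mul (FI1inv v) v) ↔
        u.1 + u.2.2 = v.1 + v.2.2)) ∧
    (∀ n : ℤ, 1 ≤ n → {u | u ∈ FI1 ∧ u.1 + u.2.2 = n}.Finite) := by
  refine ⟨?_, fun n _ => ?_⟩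
  · rintro ⟨a, p, b⟩ hu ⟨c, q, d⟩ hv
    simp only [FI1mul_inv_self, FI1inv_mul_self, Prod.mk.injEq, true_and]
    simp only [FI1, Set.mem_ofPred_eq] at hu hv ⊢
    constructor
    · rintro ⟨w, -, h₁, h₂⟩
      omega
    · intro h
      refine ⟨(a, c + q - a, b), ?_, ⟨rfl, rfl⟩, ?_, ?_⟩ <;> dsimp only at h ⊢ <;> omega
  · refine ((Set.finite_Icc 0 n).prod ((Set.finite_Icc (-n) n).prod (Set.finite_Icc 0 n))).subset ?_
    rintro ⟨a, p, b⟩ ⟨hu, hn⟩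
    simp only [FI1, Set.mem_ofPred_eq] at hu hn
    simp only [Set.mem_prod, Set.mem_Icc]
    omega
end

section
/- Let S be a nonempty inverse subsemigroup of FI₁, let a_min be the minimum of the first components of the elements of S and b_min the minimum of the third components of the elements of S. Then every element (a, m, b) ∈ S satisfies a ≥ a_min, b ≥ b_min, and -(a - a_min) ≤ m ≤ b - b_min. -/
theorem stmt_5 (S : Set (ℤ × ℤ × ℤ)) (hS : IsInvSub S)
    (amin bmin : ℤ)
    (hamin : (∃ u ∈ S, u.1 = amin) ∧ ∀ u ∈ S, amin ≤ u.1)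
    (hbmin : (∃ u ∈ S, u.2.2 = bmin) ∧ ∀ u ∈ S, bmin ≤ u.2.2) :
    ∀ u ∈ S, amin ≤ u.1 ∧ bmin ≤ u.2.2 ∧
      -(u.1 - amin) ≤ u.2.1 ∧ u.2.1 ≤ u.2.2 - bmin := by
  intro u hu
  have ha := hamin.2 _ (hS.2.2.2 u hu)
  have hb := hbmin.2 _ (hS.2.2.2 u hu)
  simp only [FI1inv] at ha hb
  exact ⟨hamin.2 u hu, hbmin.2 u hu, by linarith, by linarith⟩
end

section
/- Let S be a nonempty inverse subsemigroup of FI₁, let a_min be the minimum of the first components of the elements of S and b_min the minimum of the third components of the elements of S, and let p > 0 be such that the middle component of every element of S is a multiple of p, (a_min, p, b_α) ∈ S for some b_α, and (a_β, -p, b_min) ∈ S for some a_β. If u = (a_min + x·p + r, q·p, b_min + y·p + s) ∈ S where x, y ∈ ℕ, q ∈ ℤ, and 0 ≤ r < p, 0 ≤ s < p, then -x ≤ q ≤ y. -/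
theorem stmt_6 (S : Set (ℤ × ℤ × ℤ)) (hS : IsInvSub S)
    (amin bmin : ℤ)
    (hamin : (∃ u ∈ S, u.1 = amin) ∧ ∀ u ∈ S, amin ≤ u.1)
    (hbmin : (∃ u ∈ S, u.2.2 = bmin) ∧ ∀ u ∈ S, bmin ≤ u.2.2)
    (p : ℤ) (hp : 0 < p)
    (hdvd : ∀ u ∈ S, p ∣ u.2.1)
    (bα aβ : ℤ)
    (hα : (amin, p, bα) ∈ S) (hβ : (aβ, -p, bmin) ∈ S)
    (x y : ℕ) (q r s : ℤ)
    (hr : 0 ≤ r ∧ r < p) (hs : 0 ≤ s ∧ s < p)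
    (hu : (amin + (x : ℤ) * p + r, q * p, bmin + (y : ℤ) * p + s) ∈ S) :
    -(x : ℤ) ≤ q ∧ q ≤ (y : ℤ) := by
  have hinv := hS.2.2.2 _ hu
  have ha := hamin.2 _ hinv
  have hb := hbmin.2 _ hinv
  simp only [FI1inv] at ha hb
  constructor
  · by_contra! h
    nlinarith
  · by_contra! h
    nlinarith
end

section
/- Let u = (a, p, b) ∈ FI₁ be a non-idempotent element, i.e. p ≠ 0. If (c, 0, d) is an idempotent element of ⟨u⟩, then (c + |p|, 0, d) ∈ ⟨u⟩ and (c, 0, d + |p|) ∈ ⟨u⟩; that is, the set of idempotents of ⟨u⟩ is a |p|-periodic subset of the idempotents of FI₁. -/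
/-- Coordinate bounds shared by all elements of the inverse subsemigroup generated by
`(a, p, b)`. -/
theorem FI1genMem.singleton_bounds {a p b : ℤ} {v : ℤ × ℤ × ℤ} (h : FI1genMem {(a, p, b)} v) :
    min a (a + p) ≤ v.1 ∧ min a (a + p) ≤ v.1 + v.2.1 ∧
      min b (b - p) ≤ v.2.2 ∧ min b (b - p) ≤ v.2.2 - v.2.1 := by
  induction h with
  | base hx =>
    obtain rfl := Set.mem_singleton_iff.mp hx
    dsimp only
    omega
  | mul _ _ ihu ihv =>
    dsimp only [FI1mul]
    omega
  | inv _ ih =>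
    dsimp only [FI1inv]
    omega

theorem stmt_7 (a p b : ℤ) (hu : (a, p, b) ∈ FI1) (hp : p ≠ 0)
    (c d : ℤ) (hcd : (c, (0 : ℤ), d) ∈ FI1gen {(a, p, b)}) :
    (c + |p|, (0 : ℤ), d) ∈ FI1gen {(a, p, b)} ∧
      (c, (0 : ℤ), d + |p|) ∈ FI1gen {(a, p, b)} := by
  have he : FI1genMem {(a, p, b)} (c, 0, d) := hcd
  have hg : FI1genMem {(a, p, b)} (a, p, b) := .base rfl
  have hbounds := he.singleton_bounds
  -- The two conjugates of the idempotent by the generator, each multiplied by the idempotent.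
  have h₁ := he.mul ((hg.mul he).mul hg.inv)
  have h₂ := he.mul ((hg.inv.mul he).mul hg)
  dsimp only [FI1mul, FI1inv] at h₁ h₂ hbounds
  change FI1genMem _ _ ∧ FI1genMem _ _
  rcases lt_or_gt_of_ne hp with hneg | hpos
  · rw [abs_of_neg hneg]
    constructor
    · convert h₁ using 3 <;> omega
    · convert h₂ using 3 <;> omega
  · rw [abs_of_pos hpos]
    constructor
    · convert h₂ using 3 <;> omega
    · convert h₁ using 3 <;> omega
end

section
/- Let u = (a, p, b) ∈ FI₁ with p > 0. Then the idempotent elements of ⟨u⟩ are exactly the triples (a + i·p, 0, b + (j - 1)·p) with i, j ∈ ℕ (i, j ≥ 0) and i + j ≥ 1. -/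
/-- The powers of `(a, p, b)` with `0 < p` are the triples `(a, n * p, b + (n - 1) * p)`,
for `n ≥ 1`. -/
theorem FI1genMem_pow {a p b : ℤ} (hp : 0 < p) (n : ℕ) :
    FI1genMem {(a, p, b)} (a, ((n : ℤ) + 1) * p, b + n * p) := by
  induction n with
  | zero => exact .base (by simp)
  | succ n ih =>
    have h := ih.mul (.base (Set.mem_singleton (a, p, b)))
    have hn : 0 ≤ (n : ℤ) * p := by positivity
    convert h using 1
    simp only [FI1mul, Prod.mk.injEq]
    push_cast
    refine ⟨?_, by ring, ?_⟩
    · rw [max_eq_left]; linarith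
    · rw [max_eq_right] ; linarith

/-- The idempotents `uⁿ u⁻ⁿ`, for `n ≥ 1`. -/
theorem FI1genMem_pow_mul_inv {a p b : ℤ} (hp : 0 < p) (n : ℕ) :
    FI1genMem {(a, p, b)} (a, 0, b + n * p) := by
  have h := (FI1genMem_pow (a := a) (b := b) hp n).mul (FI1genMem_pow hp n).inv
  convert h using 1
  simp [FI1mul, FI1inv]

/-- The idempotents `u⁻ⁿ uⁿ`, for `n ≥ 1`. -/
theorem FI1genMem_inv_mul_pow {a p b : ℤ} (hp : 0 < p) (n : ℕ) :
    FI1genMem {(a, p, b)} (a + ((n : ℤ) + 1) * p, 0, b - p) := by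
  have h := (FI1genMem_pow (a := a) (b := b) hp n).inv.mul (FI1genMem_pow hp n)
  convert h using 1
  simp only [FI1mul, FI1inv, Prod.mk.injEq]
  refine ⟨?_, by ring, ?_⟩
  · rw [max_eq_left]; linarith
  · rw [max_eq_left] <;> linarith

/-- The shape of the elements of the inverse subsemigroup generated by `(a, p, b)`. -/
theorem FI1genMem.exists_eq {a p b : ℤ} (hp : 0 < p) {v : ℤ × ℤ × ℤ}
    (hv : FI1genMem {(a, p, b)} v) :
    ∃ i j k : ℤ, 0 ≤ i ∧ 0 ≤ j ∧ 1 ≤ i + j ∧ -i ≤ k ∧ k ≤ j ∧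
      v = (a + i * p, k * p, b + (j - 1) * p) := by
  induction hv with
  | base h => exact ⟨0, 1, 1, by simpa using h⟩
  | mul _ _ ihu ihv =>
    obtain ⟨i, j, k, hi, hj, hij, hik, hkj, rfl⟩ := ihu
    obtain ⟨i', j', k', hi', hj', hij', hik', hkj', rfl⟩ := ihv
    refine ⟨max i (i' - k), max j (j' + k), k + k', by omega, by omega, by omega, by omega,
      by omega, ?_⟩
    have hmax (c x y : ℤ) : max (c + x * p) (c + y * p) = c + max x y * p := by
      rw [max_add_add_left, max_mul_of_nonneg _ _ hp.le]
    simp only [FI1mul, Prod.mk.injEq]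
    refine ⟨?_, by ring, ?_⟩
    · rw [← hmax]; ring_nf
    · rw [← max_sub_sub_right, ← hmax]; ring_nf
  | inv _ ih =>
    obtain ⟨i, j, k, hi, hj, hij, hik, hkj, rfl⟩ := ih
    refine ⟨i + k, j - k, -k, by omega, by omega, by omega, by omega, by omega, ?_⟩
    simp only [FI1inv, Prod.mk.injEq]
    refine ⟨?_, ?_, ?_⟩ <;> ring

theorem stmt_8 (a p b : ℤ) (hu : (a, p, b) ∈ FI1) (hp : 0 < p) :
    {v | v ∈ FI1gen {(a, p, b)} ∧ FI1mul v v = v} =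
      {v : ℤ × ℤ × ℤ | ∃ i j : ℕ, 1 ≤ i + j ∧
        v = (a + (i : ℤ) * p, 0, b + ((j : ℤ) - 1) * p)} := by
  ext v
  constructor
  · rintro ⟨hv, hidem⟩
    obtain ⟨i, j, k, hi, hj, hij, -, -, rfl⟩ := FI1genMem.exists_eq hp hv
    have hk : k * p = 0 := by
      have h := congrArg (fun w => w.2.1) hidem
      simpa [FI1mul] using h
    lift i to ℕ using hi
    lift j to ℕ using hj
    exact ⟨i, j, by omega, by rw [hk]⟩
  · rintro ⟨i, j, hij, rfl⟩
    refine ⟨?_, by simp [FI1mul]⟩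
    change FI1genMem _ _
    rcases i with _ | i <;> rcases j with _ | j
    · omega
    · simpa using FI1genMem_pow_mul_inv (a := a) (b := b) hp j
    · simpa [sub_eq_add_neg] using FI1genMem_inv_mul_pow (a := a) (b := b) hp i
    · have h := (FI1genMem_inv_mul_pow (a := a) (b := b) hp i).mul (FI1genMem_pow_mul_inv hp j)
      have hi : 0 ≤ ((i : ℤ) + 1) * p := by positivity
      have hj : 0 ≤ (j : ℤ) * p := by positivity
      convert h using 1
      simp only [FI1mul, Prod.mk.injEq]
      push_cast
      refine ⟨?_, trivial, ?_⟩
      · rw [max_eq_left]; linarith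
      · rw [max_eq_right] <;> linarith
end

section
/- Let S be an inverse subsemigroup of FI₁ that is generated by a nonempty set of non-idempotent elements, i.e. S = ⟨T⟩ where T is the (nonempty) set of non-idempotent elements of S. Then for every idempotent e ∈ S there exists a non-idempotent element t ∈ S with t·t⁻¹ = e. -/
theorem FI1mul_self_eq_iff (u : ℤ × ℤ × ℤ) : FI1mul u u = u ↔ u.2.1 = 0 := by
  obtain ⟨a, p, b⟩ := u
  simp only [FI1mul, Prod.mk.injEq]
  omega

/-- Every element `u` of `⟨X⟩` has a range that contains the range of some non-idempotent element
of `S`, and so does its inverse, as soon as `X` consists of non-idempotent elements of `S`. -/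
theorem FI1genMem.exists_range_le {S X : Set (ℤ × ℤ × ℤ)} (hinv : ∀ u ∈ S, FI1inv u ∈ S)
    (hX : ∀ u ∈ X, u ∈ S ∧ u.2.1 ≠ 0) {u : ℤ × ℤ × ℤ} (hu : FI1genMem X u) :
    (∃ t ∈ S, t.2.1 ≠ 0 ∧ t.1 ≤ u.1 ∧ t.2.2 ≤ u.2.2) ∧
      ∃ t ∈ S, t.2.1 ≠ 0 ∧ t.1 ≤ (FI1inv u).1 ∧ t.2.2 ≤ (FI1inv u).2.2 := by
  induction hu with
  | @base u hu =>
    obtain ⟨hS, hp⟩ := hX u hu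
    exact ⟨⟨u, hS, hp, le_rfl, le_rfl⟩,
      ⟨FI1inv u, hinv u hS, neg_ne_zero.mpr hp, le_rfl, le_rfl⟩⟩
  | mul _ _ ihu ihv =>
    obtain ⟨⟨s, hs, hsp, hsa, hsb⟩, -⟩ := ihu
    obtain ⟨-, ⟨t, ht, htp, hta, htb⟩⟩ := ihv
    refine ⟨⟨s, hs, hsp, ?_, ?_⟩, ⟨t, ht, htp, ?_, ?_⟩⟩ <;>
      simp only [FI1mul, FI1inv] at * <;> omega
  | inv _ ih =>
    obtain ⟨⟨s, hs, hsp, hsa, hsb⟩, h⟩ := ih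
    refine ⟨h, ⟨s, hs, hsp, ?_, ?_⟩⟩ <;> simp only [FI1inv] <;> omega

theorem stmt_9 (S : Set (ℤ × ℤ × ℤ)) (hS : IsInvSub S)
    (hTne : {u | u ∈ S ∧ FI1mul u u ≠ u}.Nonempty)
    (hgen : S = FI1gen {u | u ∈ S ∧ FI1mul u u ≠ u}) :
    ∀ e ∈ S, FI1mul e e = e →
      ∃ t ∈ S, FI1mul t t ≠ t ∧ FI1mul t (FI1inv t) = e := by
  intro e he hee
  obtain ⟨-, -, hmul, hinv⟩ := hS
  have hmem : e ∈ FI1gen {u | u ∈ S ∧ FI1mul u u ≠ u} := hgen ▸ he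
  obtain ⟨⟨t, ht, htp, hta, htb⟩, -⟩ := FI1genMem.exists_range_le hinv
    (fun u hu => ⟨hu.1, (FI1mul_self_eq_iff u).not.mp hu.2⟩) hmem
  rw [FI1mul_self_eq_iff] at hee
  refine ⟨FI1mul e t, hmul e he t ht, ?_, ?_⟩
  · rw [Ne, FI1mul_self_eq_iff]
    simpa [FI1mul, hee] using htp
  · obtain ⟨a, p, b⟩ := e
    simp only [FI1mul, FI1inv, Prod.mk.injEq] at *
    omega
end

section
/- Let S be an inverse subsemigroup of FI₁ that is generated by a nonempty set of non-idempotent elements. Then there exists a finite set T₁ of non-idempotent elements of S such that E(S) = ⋃_{u ∈ T₁} E(⟨u⟩), i.e. the semilattice of idempotents of S is a finite union of the semilattices of idempotents of monogenic inverse subsemigroups of S. -/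
theorem FI1mul_mem {u v : ℤ × ℤ × ℤ} (hu : u ∈ FI1) (hv : v ∈ FI1) : FI1mul u v ∈ FI1 := by
  simp only [FI1, FI1mul, Set.mem_ofPred_eq] at *
  omega

theorem FI1inv_mem {u : ℤ × ℤ × ℤ} (hu : u ∈ FI1) : FI1inv u ∈ FI1 := by
  simp only [FI1, FI1inv, Set.mem_ofPred_eq] at *
  omega

theorem FI1gen_subset_FI1 {X : Set (ℤ × ℤ × ℤ)} (hX : X ⊆ FI1) : FI1gen X ⊆ FI1 := by
  intro u hu
  induction hu with
  | base h => exact hX h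
  | mul _ _ h₁ h₂ => exact FI1mul_mem h₁ h₂
  | inv _ h => exact FI1inv_mem h

theorem FI1gen_singleton_subset {X : Set (ℤ × ℤ × ℤ)} {u : ℤ × ℤ × ℤ} (hu : u ∈ FI1gen X) :
    FI1gen {u} ⊆ FI1gen X := by
  intro v hv
  induction hv with
  | base h => exact Set.mem_singleton_iff.mp h ▸ hu
  | mul _ _ h₁ h₂ => exact FI1genMem.mul h₁ h₂
  | inv _ h => exact FI1genMem.inv h

/-- If `e` and `u` are related by `u u⁻¹ = e`, then `⟨u⟩` contains every idempotent obtained from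
`e` by enlarging both outer components by multiples of the middle component of `u`. -/
theorem idempotent_mem_FI1gen_singleton (x p y : ℤ) (i j : ℕ) :
    (x + |p| * i, 0, y + |p| * j) ∈ FI1gen {(x, p, y)} := by
  have hu : FI1genMem {(x, p, y)} (x, p, y) := .base rfl
  have h₀ : FI1genMem {(x, p, y)} (x, 0, y) := by
    convert hu.mul hu.inv using 1
    simp [FI1mul, FI1inv]
  have conj : ∀ c d : ℤ, x ≤ c → y ≤ d → FI1genMem {(x, p, y)} (c, 0, d) →
      FI1genMem {(x, p, y)} (c + |p|, 0, d) ∧ FI1genMem {(x, p, y)} (c, 0, d + |p|) := by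
    intro c d hc hd h
    have h₁ := h.mul ((hu.mul h).mul hu.inv)
    have h₂ := h.mul ((hu.inv.mul h).mul hu)
    rcases le_total 0 p with hp | hp
    · rw [abs_of_nonneg hp]
      constructor
      · convert h₂ using 1
        simp only [FI1mul, FI1inv, Prod.mk.injEq]
        omega
      · convert h₁ using 1
        simp only [FI1mul, FI1inv, Prod.mk.injEq]
        omega
    · rw [abs_of_nonpos hp]
      constructor
      · convert h₁ using 1
        simp only [FI1mul, FI1inv, Prod.mk.injEq]
        omega
      · convert h₂ using 1
        simp only [FI1mul, FI1inv, Prod.mk.injEq]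
        omega
  have grow : ∀ n : ℕ, 0 ≤ |p| * (n : ℤ) := fun n => by positivity
  change FI1genMem _ _
  induction i with
  | zero =>
    induction j with
    | zero => simpa using h₀
    | succ j ih =>
      convert (conj _ _ (by simp) (by linarith [grow j]) ih).2 using 1
      push_cast
      simp only [Prod.mk.injEq, true_and]
      ring
  | succ i ih =>
    convert (conj _ _ (by linarith [grow i]) (by linarith [grow j]) ih).1 using 1
    push_cast
    simp only [Prod.mk.injEq, and_true]
    ring

/-- Every element of a subsemigroup generated by non-idempotents is dominated in its outer
components by a non-idempotent of the subsemigroup, and so is its inverse. -/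
theorem exists_nonidempotent_le {T : Set (ℤ × ℤ × ℤ)} (hT : ∀ u ∈ T, FI1mul u u ≠ u)
    {w : ℤ × ℤ × ℤ} (hw : w ∈ FI1gen T) :
    (∃ v ∈ FI1gen T, v.2.1 ≠ 0 ∧ v.1 ≤ w.1 ∧ v.2.2 ≤ w.2.2) ∧
      ∃ v ∈ FI1gen T, v.2.1 ≠ 0 ∧ v.1 ≤ (FI1inv w).1 ∧ v.2.2 ≤ (FI1inv w).2.2 := by
  induction hw with
  | @base u h =>
    have hp : u.2.1 ≠ 0 := fun h0 => hT u h ((FI1mul_self_eq_iff u).2 h0)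
    exact ⟨⟨u, .base h, hp, le_rfl, le_rfl⟩,
      ⟨FI1inv u, .inv (.base h), by simpa [FI1inv] using hp, le_rfl, le_rfl⟩⟩
  | mul _ _ h₁ h₂ =>
    obtain ⟨⟨v, hv, hp, hl, hr⟩, -⟩ := h₁
    obtain ⟨-, ⟨v', hv', hp', hl', hr'⟩⟩ := h₂
    refine ⟨⟨v, hv, hp, ?_, ?_⟩, ⟨v', hv', hp', ?_, ?_⟩⟩ <;>
      simp only [FI1mul, FI1inv] at * <;> omega
  | inv _ h =>
    obtain ⟨⟨v, hv, hp, hl, hr⟩, h'⟩ := h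
    refine ⟨h', ⟨v, hv, hp, ?_, ?_⟩⟩ <;> simp only [FI1inv] at * <;> omega

/-- Dickson's lemma in the quarter plane for the order refined by congruence modulo `p`. -/
theorem exists_finset_add_mul_cover (p : ℤ) (hp : p ≠ 0) (A : Set (ℤ × ℤ))
    (hA : ∀ z ∈ A, 0 ≤ z.1 ∧ 0 ≤ z.2) :
    ∃ F : Finset (ℤ × ℤ), (∀ z ∈ F, z ∈ A) ∧
      ∀ z ∈ A, ∃ w ∈ F, ∃ i j : ℕ, z = (w.1 + |p| * i, w.2 + |p| * j) := by
  by_contra! hcon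
  obtain ⟨f, hf, hfr⟩ := exists_seq_of_forall_finset_exists (fun z => z ∈ A)
    (fun w z => ∀ i j : ℕ, z ≠ (w.1 + |p| * i, w.2 + |p| * j)) hcon
  have hpos : 0 < |p| := abs_pos.2 hp
  have : NeZero p.natAbs := ⟨by simpa using hp⟩
  have hfin : WellQuasiOrdered (α := ZMod p.natAbs × ZMod p.natAbs) (· = ·) :=
    Finite.wellQuasiOrdered _
  have hnat : WellQuasiOrdered (α := ℕ × ℕ) (· ≤ ·) := wellQuasiOrdered_le
  obtain ⟨m, n, hmn, hle, heq⟩ := (hnat.prod hfin)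
    fun n => (((f n).1.toNat, (f n).2.toNat), (((f n).1 : ZMod _), ((f n).2 : ZMod _)))
  simp only [Prod.mk.injEq, ZMod.intCast_eq_intCast_iff_dvd_sub, Int.natCast_natAbs] at heq
  simp only [Prod.mk_le_mk] at hle
  have hm := hA _ (hf m)
  have hn := hA _ (hf n)
  obtain ⟨⟨i, hi⟩, ⟨j, hj⟩⟩ := heq
  have hi0 : 0 ≤ i := nonneg_of_mul_nonneg_right (by rw [← hi]; omega) hpos
  have hj0 : 0 ≤ j := nonneg_of_mul_nonneg_right (by rw [← hj]; omega) hpos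
  lift i to ℕ using hi0
  lift j to ℕ using hj0
  exact hfr m n hmn i j (Prod.ext (by simp only; omega) (by simp only; omega))

theorem stmt_10 (T S : Set (ℤ × ℤ × ℤ)) (hTFI : T ⊆ FI1) (hTne : T.Nonempty)
    (hTni : ∀ u ∈ T, FI1mul u u ≠ u) (hgen : S = FI1gen T) :
    ∃ T₁ : Finset (ℤ × ℤ × ℤ),
      (∀ u ∈ T₁, u ∈ S ∧ FI1mul u u ≠ u) ∧
      {e | e ∈ S ∧ FI1mul e e = e} =
        ⋃ u ∈ T₁, {e | e ∈ FI1gen {u} ∧ FI1mul e e = e} := by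
  subst hgen
  classical
  set A : Set (ℤ × ℤ) := {z | (z.1, 0, z.2) ∈ FI1gen T} with hAdef
  have hA : ∀ z ∈ A, 0 ≤ z.1 ∧ 0 ≤ z.2 := fun z hz =>
    ⟨(FI1gen_subset_FI1 hTFI hz).1, (FI1gen_subset_FI1 hTFI hz).2.1⟩
  obtain ⟨M, hMA, hM⟩ := exists_finset_add_mul_cover 1 one_ne_zero A hA
  have hdom : ∀ m ∈ A, ∃ v ∈ FI1gen T, v.2.1 ≠ 0 ∧ v.1 ≤ m.1 ∧ v.2.2 ≤ m.2 := fun m hm =>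
    (exists_nonidempotent_le hTni hm).1
  choose! v hvS hvp hvl hvr using hdom
  have hcover : ∀ m ∈ A, ∃ F : Finset (ℤ × ℤ),
      (∀ z ∈ F, z ∈ A ∧ m.1 ≤ z.1 ∧ m.2 ≤ z.2) ∧
      ∀ z ∈ A, m.1 ≤ z.1 → m.2 ≤ z.2 →
        ∃ w ∈ F, ∃ i j : ℕ, z = (w.1 + |(v m).2.1| * i, w.2 + |(v m).2.1| * j) := by
    intro m hm
    obtain ⟨F, hF, hF'⟩ := exists_finset_add_mul_cover (v m).2.1 (hvp m hm)
      {z | z ∈ A ∧ m.1 ≤ z.1 ∧ m.2 ≤ z.2} fun z hz => hA z hz.1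
    exact ⟨F, hF, fun z hz h₁ h₂ => hF' z ⟨hz, h₁, h₂⟩⟩
  choose! F hFA hF using hcover
  have hT₁ : ∀ u ∈ M.biUnion fun m => (F m).image fun z => (z.1, (v m).2.1, z.2),
      u ∈ FI1gen T ∧ FI1mul u u ≠ u := by
    intro u hu
    simp only [Finset.mem_biUnion, Finset.mem_image] at hu
    obtain ⟨m, hm, z, hz, rfl⟩ := hu
    have hmA := hMA m hm
    obtain ⟨hzA, h₁, h₂⟩ := hFA m hmA z hz
    refine ⟨?_, fun h => hvp m hmA ((FI1mul_self_eq_iff (z.1, (v m).2.1, z.2)).1 h)⟩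
    have hmul := FI1genMem.mul hzA (hvS m hmA)
    have hl := hvl m hmA
    have hr := hvr m hmA
    have heq : FI1mul (z.1, 0, z.2) (v m) = (z.1, (v m).2.1, z.2) := by
      simp only [FI1mul, Prod.mk.injEq]
      omega
    exact heq ▸ hmul
  refine ⟨_, hT₁, ?_⟩
  ext ⟨x, q, y⟩
  simp only [Set.mem_ofPred_eq, Set.mem_iUnion, exists_prop, FI1mul_self_eq_iff]
  constructor
  · rintro ⟨he, rfl⟩
    obtain ⟨m, hm, i, j, hij⟩ := hM (x, y) he
    simp only [Prod.mk.injEq, abs_one, one_mul] at hij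
    obtain ⟨w, hw, k, l, hkl⟩ := hF m (hMA m hm) (x, y) he (by simp only; omega)
      (by simp only; omega)
    simp only [Prod.mk.injEq] at hkl
    obtain ⟨rfl, rfl⟩ := hkl
    exact ⟨_, Finset.mem_biUnion.2 ⟨m, hm, Finset.mem_image_of_mem _ hw⟩,
      idempotent_mem_FI1gen_singleton _ _ _ k l, rfl⟩
  · rintro ⟨u, hu, he, rfl⟩
    exact ⟨FI1gen_singleton_subset (hT₁ u hu).1 he, rfl⟩
end

section
/- Let S be an inverse subsemigroup of FI₁ generated by a nonempty set of non-idempotent elements; let a_min, b_min be the minimum first and third components over elements of S; suppose p > 0, b_α, a_β are such that α := (a_min, p, b_α) ∈ S, β := (a_β, -p, b_min) ∈ S, and every element of S has middle component a multiple of p; set N := a_β + b_α. If u = (a, q·p, b) ∈ S with a + b > N, a = a_min + x·p + r where x ∈ ℕ and 0 ≤ r < p, and -(x - 1)·p ≤ q·p ≤ b, then (a, (q - 1)·p, b) ∈ ⟨{u, α, β}⟩. -/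
theorem stmt_11 (T S : Set (ℤ × ℤ × ℤ)) (hTFI : T ⊆ FI1) (hTne : T.Nonempty)
    (hTni : ∀ u ∈ T, FI1mul u u ≠ u) (hgen : S = FI1gen T)
    (amin bmin : ℤ)
    (hamin : (∃ u ∈ S, u.1 = amin) ∧ ∀ u ∈ S, amin ≤ u.1)
    (hbmin : (∃ u ∈ S, u.2.2 = bmin) ∧ ∀ u ∈ S, bmin ≤ u.2.2)
    (p : ℤ) (hp : 0 < p) (bα aβ : ℤ)
    (hα : (amin, p, bα) ∈ S) (hβ : (aβ, -p, bmin) ∈ S)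
    (hdvd : ∀ u ∈ S, p ∣ u.2.1)
    (a b q : ℤ) (x : ℕ) (r : ℤ)
    (hu : (a, q * p, b) ∈ S)
    (hN : aβ + bα < a + b)
    (ha : a = amin + (x : ℤ) * p + r) (hr : 0 ≤ r ∧ r < p)
    (hq : -((x : ℤ) - 1) * p ≤ q * p ∧ q * p ≤ b) :
    (a, (q - 1) * p, b) ∈ FI1gen {(a, q * p, b), (amin, p, bα), (aβ, -p, bmin)} := by
  subst hgen
  set X : Set (ℤ × ℤ × ℤ) := {(a, q * p, b), (amin, p, bα), (aβ, -p, bmin)}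
  have hXu : FI1genMem X (a, q * p, b) := .base (by simp [X])
  have hXα : FI1genMem X (amin, p, bα) := .base (by simp [X])
  have hXβ : FI1genMem X (aβ, -p, bmin) := .base (by simp [X])
  have hb : bmin ≤ b - q * p := hbmin.2 _ (FI1genMem.inv hu)
  obtain h | h := le_or_gt (bα - p + q * p) b
  · have hmul : FI1mul (a, q * p, b) (FI1inv (amin, p, bα)) = (a, (q - 1) * p, b) := by
      simp only [FI1mul, FI1inv, Prod.mk.injEq]
      exact ⟨max_eq_left (by linarith [hq.1, hr.1]), by ring, max_eq_left h⟩
    exact hmul ▸ hXu.mul hXα.inv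
  · have hmul : FI1mul (a, q * p, b) (aβ, -p, bmin) = (a, (q - 1) * p, b) := by
      simp only [FI1mul, Prod.mk.injEq]
      exact ⟨max_eq_left (by linarith), by ring, max_eq_left (by linarith)⟩
    exact hmul ▸ hXu.mul hXβ
end

section
/- Let S be an inverse subsemigroup of FI₁ generated by a nonempty set of non-idempotent elements; let a_min, b_min be the minimum first and third components over elements of S; suppose p > 0, b_α, a_β are such that α := (a_min, p, b_α) ∈ S, β := (a_β, -p, b_min) ∈ S, and every element of S has middle component a multiple of p; set N := a_β + b_α. If u = (a, q·p, b) ∈ S with a + b > N, b = b_min + y·p + s where y ∈ ℕ and 0 ≤ s < p, and -a ≤ q·p ≤ (y - 1)·p, then (a, (q + 1)·p, b) ∈ ⟨{u, α, β}⟩. -/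
theorem stmt_12 (T S : Set (ℤ × ℤ × ℤ)) (hTFI : T ⊆ FI1) (hTne : T.Nonempty)
    (hTni : ∀ u ∈ T, FI1mul u u ≠ u) (hgen : S = FI1gen T)
    (amin bmin : ℤ)
    (hamin : (∃ u ∈ S, u.1 = amin) ∧ ∀ u ∈ S, amin ≤ u.1)
    (hbmin : (∃ u ∈ S, u.2.2 = bmin) ∧ ∀ u ∈ S, bmin ≤ u.2.2)
    (p : ℤ) (hp : 0 < p) (bα aβ : ℤ)
    (hα : (amin, p, bα) ∈ S) (hβ : (aβ, -p, bmin) ∈ S)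
    (hdvd : ∀ u ∈ S, p ∣ u.2.1)
    (a b q : ℤ) (y : ℕ) (s : ℤ)
    (hu : (a, q * p, b) ∈ S)
    (hN : aβ + bα < a + b)
    (hb : b = bmin + (y : ℤ) * p + s) (hs : 0 ≤ s ∧ s < p)
    (hq : -a ≤ q * p ∧ q * p ≤ ((y : ℤ) - 1) * p) :
    (a, (q + 1) * p, b) ∈ FI1gen {(a, q * p, b), (amin, p, bα), (aβ, -p, bmin)} := by
  subst hgen
  have ha : amin ≤ a + q * p := hamin.2 _ (.inv hu)
  obtain hle | hlt := le_or_gt (q * p) (b - bα)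
  · have hmul : (a, (q + 1) * p, b) = FI1mul (a, q * p, b) (amin, p, bα) := by
      simp only [FI1mul, Prod.mk.injEq]
      exact ⟨(max_eq_left (by linarith)).symm, by ring, (max_eq_left (by linarith)).symm⟩
    rw [hmul]
    exact .mul (.base (by simp)) (.base (by simp))
  · have hmul : (a, (q + 1) * p, b) =
        FI1mul (a, q * p, b) (FI1inv (aβ, -p, bmin)) := by
      simp only [FI1mul, FI1inv, Prod.mk.injEq]
      exact ⟨(max_eq_left (by linarith)).symm, by ring, (max_eq_left (by linarith)).symm⟩
    rw [hmul]
    exact .mul (.base (by simp)) (.inv (.base (by simp)))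
end

section
/- (Theorem A) Let T be a nonempty set of non-idempotent elements of FI₁ and let S = ⟨T⟩ be the inverse subsemigroup of FI₁ generated by T. Then S is finitely generated: there exists a finite set F ⊆ S with ⟨F⟩ = S. -/
/-- The element of `FI₁` with positive shift `p` whose interval overhangs `[0, p]` by `a` on the
left and by `c` on the right. -/
def ofOverhang (a p c : ℕ) : ℤ × ℤ × ℤ := (a, p, p + c)

lemma FI1genMem.congr {X : Set (ℤ × ℤ × ℤ)} {u v : ℤ × ℤ × ℤ} (h : FI1genMem X u)
    (h₁ : u.1 = v.1) (h₂ : u.2.1 = v.2.1) (h₃ : u.2.2 = v.2.2) : FI1genMem X v := by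
  have : u = v := Prod.ext h₁ (Prod.ext h₂ h₃)
  exact this ▸ h

lemma FI1genMem.mono {X Y : Set (ℤ × ℤ × ℤ)} (h : ∀ u ∈ X, FI1genMem Y u) {u : ℤ × ℤ × ℤ}
    (hu : FI1genMem X u) : FI1genMem Y u := by
  induction hu with
  | base hu => exact h _ hu
  | mul _ _ h₁ h₂ => exact h₁.mul h₂
  | inv _ h₁ => exact h₁.inv

lemma FI1genMem.ofOverhang_pow {X : Set (ℤ × ℤ × ℤ)} {a p c : ℕ}
    (h : FI1genMem X (ofOverhang a p c)) (n : ℕ) :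
    FI1genMem X (ofOverhang a ((n + 1) * p) c) := by
  induction n with
  | zero => simpa using h
  | succ n ih =>
    have hp : (n + 1 + 1) * p = (n + 1) * p + p := by ring
    rw [hp]
    generalize (n + 1) * p = q at ih
    refine (ih.mul h).congr ?_ ?_ ?_ <;> simp only [FI1mul, ofOverhang] <;> omega

/-- With a generator `ofOverhang a₀ d c₀` of minimal overhangs, the shift of `ofOverhang a p c` may
be increased by any multiple of `d`. -/
lemma FI1genMem.ofOverhang_add_shift {X : Set (ℤ × ℤ × ℤ)} {a p c a₀ d c₀ : ℕ}
    (hz : FI1genMem X (ofOverhang a₀ d c₀)) (h : FI1genMem X (ofOverhang a p c))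
    (ha : a₀ ≤ a) (hc : c₀ ≤ c) (k : ℕ) :
    FI1genMem X (ofOverhang a (p + k * d) c) := by
  obtain _ | k := k
  · simpa using h
  have hk := hz.ofOverhang_pow k
  generalize (k + 1) * d = e at hk
  refine ((h.mul h.inv).mul (hk.mul h)).congr ?_ ?_ ?_ <;>
    simp only [FI1mul, FI1inv, ofOverhang] <;> omega

lemma FI1genMem.left_idempotent {X : Set (ℤ × ℤ × ℤ)} {a p c a₀ d c₀ : ℕ}
    (hz : FI1genMem X (ofOverhang a₀ d c₀)) (h : FI1genMem X (ofOverhang a p c))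
    (ha : a₀ ≤ a) {n : ℕ} (hn : n ≠ 0) (hb : p + c ≤ n * d) :
    FI1genMem X (((a + n * d : ℕ) : ℤ), 0, (c₀ : ℤ)) := by
  obtain ⟨n, rfl⟩ := Nat.exists_eq_succ_of_ne_zero hn
  have hk := hz.ofOverhang_pow n
  simp only [Nat.succ_eq_add_one] at *
  generalize (n + 1) * d = e at hk hb
  refine ((hk.inv.mul (h.mul h.inv)).mul hk).congr ?_ ?_ ?_ <;>
    simp only [FI1mul, FI1inv, ofOverhang] <;> omega

lemma FI1genMem.right_idempotent {X : Set (ℤ × ℤ × ℤ)} {a p c a₀ d c₀ : ℕ}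
    (hz : FI1genMem X (ofOverhang a₀ d c₀)) (h : FI1genMem X (ofOverhang a p c))
    (hc : c₀ ≤ c) {m : ℕ} (hm : m ≠ 0) (hb : a + p ≤ m * d) :
    FI1genMem X ((a₀ : ℤ), 0, ((c + m * d : ℕ) : ℤ)) := by
  obtain ⟨m, rfl⟩ := Nat.exists_eq_succ_of_ne_zero hm
  have hk := hz.ofOverhang_pow m
  simp only [Nat.succ_eq_add_one] at *
  generalize (m + 1) * d = e at hk hb
  refine ((hk.mul (h.inv.mul h)).mul hk.inv).congr ?_ ?_ ?_ <;>
    simp only [FI1mul, FI1inv, ofOverhang] <;> omega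

/-- The triple `y` of overhang data dominates `x` modulo `d`: all entries agree modulo `d` and do
not decrease, and each overhang is either unchanged or increases by a large amount. -/
def Dominates (d : ℕ) (x y : ℕ × ℕ × ℕ) : Prop :=
  (∃ k, y.2.1 = x.2.1 + k * d) ∧
  (∃ n, y.1 = x.1 + n * d ∧ (n = 0 ∨ x.2.1 + x.2.2 ≤ n * d)) ∧
  ∃ m, y.2.2 = x.2.2 + m * d ∧ (m = 0 ∨ x.1 + x.2.1 ≤ m * d)

lemma FI1genMem.of_dominates {X : Set (ℤ × ℤ × ℤ)} {a₀ d c₀ : ℕ} {x y : ℕ × ℕ × ℕ}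
    (hz : FI1genMem X (ofOverhang a₀ d c₀)) (h : FI1genMem X (ofOverhang x.1 x.2.1 x.2.2))
    (ha : a₀ ≤ x.1) (hc : c₀ ≤ x.2.2) (hxy : Dominates d x y) :
    FI1genMem X (ofOverhang y.1 y.2.1 y.2.2) := by
  obtain ⟨a, p, c⟩ := x
  obtain ⟨a', p', c'⟩ := y
  obtain ⟨⟨k, hk⟩, ⟨n, hn, hn'⟩, m, hm, hm'⟩ := hxy
  simp only at *
  subst hk hn hm
  have hw := hz.ofOverhang_add_shift h ha hc k
  have hl : FI1genMem X (ofOverhang (a + n * d) (p + k * d) c) := by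
    by_cases hn0 : n = 0
    · simpa [hn0] using hw
    · have he := hz.left_idempotent h ha hn0 (hn'.resolve_left hn0)
      generalize n * d = e at he
      generalize p + k * d = q at hw
      refine (he.mul hw).congr ?_ ?_ ?_ <;> simp only [FI1mul, ofOverhang] <;> omega
  by_cases hm0 : m = 0
  · simpa [hm0] using hl
  · have hf := hz.right_idempotent h hc hm0 (hm'.resolve_left hm0)
    generalize m * d = e at hf
    generalize p + k * d = q at hl
    generalize n * d = s at hl
    refine (hl.mul hf).congr ?_ ?_ ?_ <;> simp only [FI1mul, ofOverhang] <;> omega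

lemma Monotone.exists_forall_eq_or_unbounded {f : ℕ → ℕ} (hf : Monotone f) :
    ∃ i, ∀ i' ≥ i, ∀ K, ∃ j, ∀ j' ≥ j, f j' = f i' ∨ f i' + K ≤ f j' := by
  by_cases h : ∃ B, ∀ n, f n ≤ B
  · obtain ⟨B, hB⟩ := h
    have hbdd : BddAbove (Set.range f) := ⟨B, by rintro _ ⟨n, rfl⟩; exact hB n⟩
    obtain ⟨i, hi⟩ := Nat.sSup_mem (Set.range_nonempty f) hbdd
    have hmax : ∀ n, f n ≤ f i := fun n => hi ▸ le_csSup hbdd ⟨n, rfl⟩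
    exact ⟨i, fun i' hi' K => ⟨i, fun j' hj' => Or.inl <|
      ((hmax j').antisymm (hf hj')).trans ((hmax i').antisymm (hf hi')).symm⟩⟩
  · push Not at h
    refine ⟨0, fun i' _ K => ?_⟩
    obtain ⟨j, hj⟩ := h (f i' + K)
    exact ⟨j, fun j' hj' => Or.inr (hj.le.trans (hf hj'))⟩

lemma exists_mul_of_le_of_mod_eq {d a b : ℕ} (hab : a ≤ b) (hd : a % d = b % d) :
    ∃ k, b = a + k * d := by
  obtain ⟨k, hk⟩ := (Nat.modEq_iff_dvd' hab).1 hd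
  exact ⟨k, by rw [mul_comm]; omega⟩

lemma exists_dominates_of_seq {d : ℕ} (hd : 0 < d) (f : ℕ → ℕ × ℕ × ℕ) :
    ∃ i j, i < j ∧ Dominates d (f i) (f j) := by
  have : NeZero d := ⟨hd.ne'⟩
  let res : ℕ → Fin d := fun a => ⟨a % d, Nat.mod_lt _ hd⟩
  let r : (ℕ × ℕ × ℕ) × (Fin d × Fin d × Fin d) → (ℕ × ℕ × ℕ) × (Fin d × Fin d × Fin d) → Prop :=
    fun x y => x.1 ≤ y.1 ∧ x.2 = y.2
  have hr : WellQuasiOrdered r :=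
    (wellQuasiOrdered_le (α := ℕ × ℕ × ℕ)).prod
      (Finite.wellQuasiOrdered (α := Fin d × Fin d × Fin d) (· = ·))
  have : IsPreorder _ r :=
    { refl := fun x => ⟨le_rfl, rfl⟩
      trans := fun x y z h₁ h₂ => ⟨h₁.1.trans h₂.1, h₁.2.trans h₂.2⟩ }
  obtain ⟨g, hg⟩ := hr.exists_monotone_subseq
    fun n => (f n, res (f n).1, res (f n).2.1, res (f n).2.2)
  have hle : ∀ m n, m ≤ n → f (g m) ≤ f (g n) := fun m n h => (hg m n h).1
  obtain ⟨i₁, h₁⟩ := Monotone.exists_forall_eq_or_unbounded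
    (f := fun n => (f (g n)).1) fun m n h => (hle m n h).1
  obtain ⟨i₂, h₂⟩ := Monotone.exists_forall_eq_or_unbounded
    (f := fun n => (f (g n)).2.2) fun m n h => (hle m n h).2.2
  let i := max i₁ i₂
  obtain ⟨j₁, h₁⟩ := h₁ i (le_max_left _ _) ((f (g i)).2.1 + (f (g i)).2.2)
  obtain ⟨j₂, h₂⟩ := h₂ i (le_max_right _ _) ((f (g i)).1 + (f (g i)).2.1)
  let j := max (i + 1) (max j₁ j₂)
  have hij : i < j := (Nat.lt_succ_self i).trans_le (le_max_left _ _)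
  have h₁ := h₁ j ((le_max_left _ _).trans (le_max_right _ _))
  have h₂ := h₂ j ((le_max_right _ _).trans (le_max_right _ _))
  obtain ⟨⟨ha, hp, hc⟩, hmod⟩ := hg i j hij.le
  simp only [res, Prod.mk.injEq, Fin.mk.injEq] at hmod ha hp hc h₁ h₂
  obtain ⟨n, hn⟩ := exists_mul_of_le_of_mod_eq ha hmod.1
  obtain ⟨m, hm⟩ := exists_mul_of_le_of_mod_eq hc hmod.2.2
  refine ⟨g i, g j, g.strictMono hij, exists_mul_of_le_of_mod_eq hp hmod.2.1,
    ⟨n, hn, ?_⟩, m, hm, ?_⟩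
  · rcases h₁ with h | h
    · left
      have : n * d = 0 := by omega
      exact (mul_eq_zero.1 this).resolve_right hd.ne'
    · right; omega
  · rcases h₂ with h | h
    · left
      have : m * d = 0 := by omega
      exact (mul_eq_zero.1 this).resolve_right hd.ne'
    · right; omega

/-- A nonidempotent element of `FI₁` or its inverse has positive shift. -/
lemma exists_ofOverhang {u : ℤ × ℤ × ℤ} (hu : u ∈ FI1) (hne : FI1mul u u ≠ u) :
    ∃ a p c : ℕ, 0 < p ∧ (u = ofOverhang a p c ∨ u = FI1inv (ofOverhang a p c)) := by
  obtain ⟨a, p, b⟩ := u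
  obtain ⟨ha, hb, -, hl, hr⟩ := hu
  simp only at *
  rcases lt_trichotomy p 0 with hp | rfl | hp
  · refine ⟨(a + p).toNat, (-p).toNat, b.toNat, by omega, Or.inr ?_⟩
    simp only [FI1inv, ofOverhang, Prod.mk.injEq]
    omega
  · simp [FI1mul] at hne
  · refine ⟨a.toNat, p.toNat, (b - p).toNat, by omega, Or.inl ?_⟩
    simp only [ofOverhang, Prod.mk.injEq]
    omega

/-- If some positive shift occurs, then one element realizes both minimal overhangs. -/
lemma exists_minimal_overhang {X : Set (ℤ × ℤ × ℤ)}
    (hne : ∃ a p c : ℕ, 0 < p ∧ FI1genMem X (ofOverhang a p c)) :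
    ∃ a₀ d c₀ : ℕ, 0 < d ∧ FI1genMem X (ofOverhang a₀ d c₀) ∧
      ∀ a p c : ℕ, 0 < p → FI1genMem X (ofOverhang a p c) → a₀ ≤ a ∧ c₀ ≤ c := by
  classical
  have hl : ∃ a p c : ℕ, 0 < p ∧ FI1genMem X (ofOverhang a p c) := hne
  have hr : ∃ c a p : ℕ, 0 < p ∧ FI1genMem X (ofOverhang a p c) := by
    obtain ⟨a, p, c, h⟩ := hne
    exact ⟨c, a, p, h⟩
  obtain ⟨p, c, hp, hx⟩ := Nat.find_spec hl
  obtain ⟨a, q, hq, hy⟩ := Nat.find_spec hr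
  refine ⟨Nat.find hl, (a + 1) * p + (c + 1) * q, Nat.find hr, by positivity, ?_,
    fun a p c hp h => ⟨Nat.find_min' hl ⟨p, c, hp, h⟩, Nat.find_min' hr ⟨a, p, hp, h⟩⟩⟩
  have hx' := hx.ofOverhang_pow a
  have hy' := hy.ofOverhang_pow c
  have ha : a ≤ (a + 1) * p := by nlinarith
  have hc : c ≤ (c + 1) * q := by nlinarith
  generalize (a + 1) * p = s at *
  generalize (c + 1) * q = t at *
  refine (hx'.mul hy').congr ?_ ?_ ?_ <;> simp only [FI1mul, ofOverhang] <;> omega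

theorem stmt_14 (T S : Set (ℤ × ℤ × ℤ)) (hTFI : T ⊆ FI1) (hTne : T.Nonempty)
    (hTni : ∀ u ∈ T, FI1mul u u ≠ u) (hgen : S = FI1gen T) :
    ∃ F : Finset (ℤ × ℤ × ℤ), ↑F ⊆ S ∧ FI1gen ↑F = S := by
  classical
  subst hgen
  have hpos : ∀ u ∈ T, ∃ a p c : ℕ, 0 < p ∧ FI1genMem T (ofOverhang a p c) ∧
      (u = ofOverhang a p c ∨ u = FI1inv (ofOverhang a p c)) := by
    intro u hu
    obtain ⟨a, p, c, hp, h⟩ := exists_ofOverhang (hTFI hu) (hTni u hu)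
    refine ⟨a, p, c, hp, ?_, h⟩
    have hu' : FI1genMem T u := .base hu
    rcases h with rfl | rfl
    · exact hu'
    · refine hu'.inv.congr ?_ ?_ ?_ <;> simp only [FI1inv, ofOverhang] <;> omega
  obtain ⟨a₀, d, c₀, hd, hz, hmin⟩ := exists_minimal_overhang (X := T) <| by
    obtain ⟨u, hu⟩ := hTne
    obtain ⟨a, p, c, hp, h, -⟩ := hpos u hu
    exact ⟨a, p, c, hp, h⟩
  let P : ℕ × ℕ × ℕ → Prop := fun x => 0 < x.2.1 ∧ FI1genMem T (ofOverhang x.1 x.2.1 x.2.2)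
  obtain ⟨s, hs, hdom⟩ : ∃ s : Finset (ℕ × ℕ × ℕ), (∀ x ∈ s, P x) ∧
      ∀ y, P y → ∃ x ∈ s, Dominates d x y := by
    by_contra! h
    obtain ⟨f, -, hf⟩ := exists_seq_of_forall_finset_exists P (fun x y => ¬ Dominates d x y) h
    obtain ⟨i, j, hij, h⟩ := exists_dominates_of_seq hd f
    exact hf i j hij h
  let F : Finset (ℤ × ℤ × ℤ) :=
    insert (ofOverhang a₀ d c₀) (s.image fun x => ofOverhang x.1 x.2.1 x.2.2)
  have hF : ∀ u ∈ (F : Set (ℤ × ℤ × ℤ)), FI1genMem T u := by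
    intro u hu
    simp only [F, Finset.coe_insert, Finset.coe_image, Set.mem_insert_iff, Set.mem_image] at hu
    rcases hu with rfl | ⟨x, hx, rfl⟩
    · exact hz
    · exact (hs x hx).2
  refine ⟨F, hF, Set.Subset.antisymm (fun u hu => FI1genMem.mono hF hu)
    fun u hu => FI1genMem.mono (fun v hv => ?_) hu⟩
  obtain ⟨a, p, c, hp, h, hv⟩ := hpos v hv
  have hmem : FI1genMem (F : Set (ℤ × ℤ × ℤ)) (ofOverhang a p c) := by
    obtain ⟨x, hx, hxy⟩ := hdom (a, p, c) ⟨hp, h⟩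
    obtain ⟨ha, hc⟩ := hmin _ _ _ (hs x hx).1 (hs x hx).2
    exact FI1genMem.of_dominates (.base (Finset.mem_insert_self _ _))
      (.base (Finset.mem_insert_of_mem (Finset.mem_image.2 ⟨x, hx, rfl⟩))) ha hc hxy
  rcases hv with rfl | rfl
  · exact hmem
  · exact hmem.inv
end

section
/- Let S be the inverse subsemigroup of FI₁ generated by the set {(n, 0, 0) : n ∈ ℕ, n ≥ 1} ∪ {(1, 2, 3)}. Then S is not finitely generated: there is no finite set F ⊆ FI₁ with ⟨F⟩ = S. -/
/-- Elements generated by `X` either are idempotents `(a, 0, 0)` with `a ∈ A`, or have both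
their own and their inverse's third component positive, provided this holds for `X`. -/
theorem FI1genMem.idempotent_or_pos {X : Set (ℤ × ℤ × ℤ)} {A : Set ℤ}
    (hX : ∀ u ∈ X, (u.1 ∈ A ∧ u.2.1 = 0 ∧ u.2.2 = 0) ∨ (1 ≤ u.2.2 ∧ 1 ≤ u.2.2 - u.2.1))
    {u : ℤ × ℤ × ℤ} (hu : FI1genMem X u) :
    (u.1 ∈ A ∧ u.2.1 = 0 ∧ u.2.2 = 0) ∨ (1 ≤ u.2.2 ∧ 1 ≤ u.2.2 - u.2.1) := by
  induction hu with
  | base h => exact hX _ h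
  | @mul u v _ _ hu hv =>
    simp only [FI1mul]
    rcases hu with ⟨hu, hp, hb⟩ | hu
    · rcases hv with ⟨hv, hq, hc⟩ | hv
      · left
        refine ⟨?_, by omega, by omega⟩
        rw [hp, sub_zero]
        rcases max_choice u.1 v.1 with h | h <;> rwa [h]
      · right
        omega
    · right
      omega
  | @inv u _ hu =>
    simp only [FI1inv]
    rcases hu with ⟨hu, hp, hb⟩ | hu
    · left
      rw [hp, hb, add_zero]
      exact ⟨hu, rfl, rfl⟩
    · right
      omega

theorem stmt_17 :
    ¬ ∃ F : Finset (ℤ × ℤ × ℤ), ↑F ⊆ FI1 ∧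
      FI1gen ↑F =
        FI1gen ({u : ℤ × ℤ × ℤ | ∃ n : ℕ, 1 ≤ n ∧ u = ((n : ℤ), 0, 0)} ∪
          {((1 : ℤ), 2, 3)}) := by
  rintro ⟨F, -, hF⟩
  obtain ⟨N, hN⟩ := (F.image Prod.fst).bddAbove
  have hFX : ∀ u ∈ (F : Set (ℤ × ℤ × ℤ)),
      (u.1 ∈ Set.Iic N ∧ u.2.1 = 0 ∧ u.2.2 = 0) ∨ (1 ≤ u.2.2 ∧ 1 ≤ u.2.2 - u.2.1) := by
    intro u hu
    have huS := hF.subset (FI1genMem.base hu)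
    have key := FI1genMem.idempotent_or_pos (A := Set.univ) (by
      rintro v (⟨n, -, rfl⟩ | rfl) <;> simp) huS
    exact key.imp_left fun h => ⟨hN (Finset.mem_coe.2 (Finset.mem_image_of_mem _ hu)), h.2⟩
  have hmem : ((((N.toNat + 1 : ℕ) : ℤ), 0, 0) : ℤ × ℤ × ℤ) ∈ FI1gen (F : Set (ℤ × ℤ × ℤ)) := by
    rw [hF]
    exact FI1genMem.base (Or.inl ⟨N.toNat + 1, by omega, rfl⟩)
  have h := FI1genMem.idempotent_or_pos hFX hmem
  simp only [Set.mem_Iic] at h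
  omega
end
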